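/- Let d ≥ 5 and let u be a classical solution of the wave-Hartree equation on [a,b] × ℝ^d which is compactly supported in space on [a,b]. Set M = sup_{t∈[a,b]} ∫_{ℝ^d} (|∇u(t,x)|² + |∂ₜu(t,x)|²) dx and assume M < ∞. Then there exists a constant C depending only on d such that ∫_a^b ∫_{ℝ^d} [ |∇_θu(t,x)|²/|x| + ((d−1)(d−3)/4) · |u(t,x)|²/|x|³ ] dx dt ≤ C · M. -/

import Mathlib

open MeasureTheory
open scoped ENNReal RealInnerProductSpace

noncomputable section

/-- Euclidean space `ℝ^d`. -/
abbrev Ed (d : ℕ) : Type := EuclideanSpace ℝ (Fin d)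

/-- The time derivative `∂ₜ u (t,x)`. -/
def timeDeriv {d : ℕ} (u : ℝ → Ed d → ℝ) (t : ℝ) (x : Ed d) : ℝ :=
  deriv (fun s => u s x) t

/-- The spatial Laplacian `Δ f (x) = ∑ i ∂²f/∂xᵢ²`. -/
def spaceLaplacian {d : ℕ} (f : Ed d → ℝ) (x : Ed d) : ℝ :=
  ∑ i : Fin d, iteratedDeriv 2 (fun s : ℝ => f (x + s • EuclideanSpace.single i 1)) 0

/-- The Hartree potential `(|·|⁻⁴ ∗ f²)(x) = ∫ f(y)² |x-y|⁻⁴ dy`. -/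
def hartreePot {d : ℕ} (f : Ed d → ℝ) (x : Ed d) : ℝ :=
  ∫ y : Ed d, (f y) ^ 2 / ‖x - y‖ ^ 4

/-- `u` is a classical (C²) solution of the defocusing energy-critical wave-Hartree
equation `∂ₜₜu - Δu + (|·|⁻⁴ ∗ |u|²) u = 0` on the time interval `I`. -/
def IsWaveHartreeSol {d : ℕ} (I : Set ℝ) (u : ℝ → Ed d → ℝ) : Prop :=
  ContDiff ℝ 2 (fun p : ℝ × Ed d => u p.1 p.2) ∧
  ∀ t ∈ I, ∀ x : Ed d,
    iteratedDeriv 2 (fun s => u s x) t - spaceLaplacian (u t) x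
      + hartreePot (u t) x * u t x = 0

/-- The angular part of the gradient: `∇_θ f(x) = ∇f(x) - (x/|x|)⟨x/|x|, ∇f(x)⟩`. -/
def angularGrad {d : ℕ} (f : Ed d → ℝ) (x : Ed d) : Ed d :=
  gradient f x - ⟪‖x‖⁻¹ • x, gradient f x⟫ • (‖x‖⁻¹ • x)

open Filter Topology

section SpatialIdentities

variable {d : ℕ}

lemma sum_coord_mul_apply (L : Ed d →L[ℝ] ℝ) (x : Ed d) :
    ∑ i, x i * L (EuclideanSpace.single i 1) = L x := by
  conv_rhs => rw [← (EuclideanSpace.basisFun (Fin d) ℝ).sum_repr x]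
  simp [map_sum]

lemma inner_single_one (x : Ed d) (i : Fin d) :
    ⟪x, (EuclideanSpace.single i 1 : Ed d)⟫ = x i := by
  rw [EuclideanSpace.inner_single_right]; simp

lemma integral_sum_fderiv_eq_zero {F : Fin d → Ed d → ℝ} (hF : ∀ i, ContDiff ℝ 1 (F i))
    (hc : ∀ i, HasCompactSupport (F i)) :
    ∫ x, ∑ i, fderiv ℝ (F i) x (EuclideanSpace.single i 1) = 0 := by
  have hint : ∀ i, Integrable fun x => fderiv ℝ (F i) x (EuclideanSpace.single i 1) := fun i =>
    (((hF i).continuous_fderiv one_ne_zero).clm_apply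
      continuous_const).integrable_of_hasCompactSupport ((hc i).fderiv_apply ℝ _)
  rw [integral_finsetSum _ fun i _ => hint i]
  refine Finset.sum_eq_zero fun i _ => ?_
  have := integral_mul_fderiv_eq_neg_fderiv_mul_of_integrable (μ := volume)
    (f := fun _ : Ed d => (1 : ℝ)) (g := F i) (v := EuclideanSpace.single i 1)
    (by simp) (by simpa using hint i)
    (by simpa using (hF i).continuous.integrable_of_hasCompactSupport (hc i))
    (fun _ _ => by fun_prop) (fun x _ => (hF i).differentiable one_ne_zero x)
  simpa using this

/-- The smoothed inverse norm `(‖x‖² + e)^(-1/2)`. -/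
def invJap (e : ℝ) (x : Ed d) : ℝ := (√(‖x‖ ^ 2 + e))⁻¹

variable {e : ℝ}

lemma invJap_pos (he : 0 < e) (x : Ed d) : 0 < invJap e x := by
  unfold invJap; positivity

lemma invJap_sq_mul (he : 0 < e) (x : Ed d) : invJap e x ^ 2 * (‖x‖ ^ 2 + e) = 1 := by
  have h : 0 < ‖x‖ ^ 2 + e := by positivity
  rw [invJap, inv_pow, Real.sq_sqrt h.le, inv_mul_cancel₀ h.ne']

lemma contDiff_invJap (he : 0 < e) {n : WithTop ℕ∞} : ContDiff ℝ n (invJap e : Ed d → ℝ) := by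
  have h : ∀ x : Ed d, 0 < ‖x‖ ^ 2 + e := fun x => by positivity
  exact (((contDiff_norm_sq ℝ).add contDiff_const).sqrt fun x => (h x).ne').inv
    fun x => (Real.sqrt_pos.2 (h x)).ne'

lemma hasFDerivAt_invJap (he : 0 < e) (x : Ed d) :
    HasFDerivAt (invJap e) (-(invJap e x ^ 3) • innerSL ℝ x) x := by
  have h : 0 < ‖x‖ ^ 2 + e := by positivity
  have h1 := (hasDerivAt_inv (Real.sqrt_pos.2 h).ne').comp_hasFDerivAt x
    (((hasStrictFDerivAt_norm_sq x).hasFDerivAt.add_const e).sqrt h.ne')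
  refine h1.congr_fderiv ?_
  ext v
  have h2 : √(‖x‖ ^ 2 + e) ≠ 0 := (Real.sqrt_pos.2 h).ne'
  simp [invJap]
  field_simp

/-- The Laplacian of `√(‖x‖² + e)`. -/
def japLap (e : ℝ) (x : Ed d) : ℝ := ((d : ℝ) - 1) * invJap e x + e * invJap e x ^ 3

/-- The coefficient of `-x` in the gradient of `japLap`. -/
def japLap₁ (e : ℝ) (x : Ed d) : ℝ := ((d : ℝ) - 1) * invJap e x ^ 3 + 3 * e * invJap e x ^ 5

/-- The coefficient of `-x` in the gradient of `japLap₁`. -/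
def japLap₂ (e : ℝ) (x : Ed d) : ℝ := 3 * ((d : ℝ) - 1) * invJap e x ^ 5 + 15 * e * invJap e x ^ 7

lemma contDiff_japLap (he : 0 < e) {n : WithTop ℕ∞} : ContDiff ℝ n (japLap e : Ed d → ℝ) := by
  have := contDiff_invJap (d := d) he (n := n)
  unfold japLap; fun_prop

lemma contDiff_japLap₁ (he : 0 < e) {n : WithTop ℕ∞} : ContDiff ℝ n (japLap₁ e : Ed d → ℝ) := by
  have := contDiff_invJap (d := d) he (n := n)
  unfold japLap₁; fun_prop

lemma hasFDerivAt_japLap (he : 0 < e) (x : Ed d) :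
    HasFDerivAt (japLap e) (-(japLap₁ e x) • innerSL ℝ x) x := by
  have h := hasFDerivAt_invJap he x
  refine ((h.const_mul ((d : ℝ) - 1)).add ((h.pow 3).const_mul e)).congr_fderiv ?_
  ext v
  simp [japLap₁]
  ring

lemma hasFDerivAt_japLap₁ (he : 0 < e) (x : Ed d) :
    HasFDerivAt (japLap₁ e) (-(japLap₂ e x) • innerSL ℝ x) x := by
  have h := hasFDerivAt_invJap he x
  refine (((h.pow 3).const_mul ((d : ℝ) - 1)).add ((h.pow 5).const_mul (3 * e))).congr_fderiv ?_
  ext v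
  simp [japLap₂]
  ring

/-- The Morawetz multiplier `∇a · ∇f + ½ (Δa) f` for the weight `a = √(‖x‖² + e)`. -/
def morMul (e : ℝ) (f : Ed d → ℝ) (x : Ed d) : ℝ :=
  invJap e x * fderiv ℝ f x x + 1 / 2 * japLap e x * f x

/-- The squared length of the gradient in coordinates. -/
def gradSq (f : Ed d → ℝ) (x : Ed d) : ℝ := ∑ i, fderiv ℝ f x (EuclideanSpace.single i 1) ^ 2

variable {f : Ed d → ℝ}

lemma contDiff_morMul (he : 0 < e) (hf : ContDiff ℝ 2 f) : ContDiff ℝ 1 (morMul e f) := by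
  have h1 := contDiff_invJap (d := d) he (n := 1)
  have h2 := contDiff_japLap (d := d) he (n := 1)
  have h3 : ContDiff ℝ 1 (fderiv ℝ f) := hf.fderiv_right (by norm_num)
  have h4 : ContDiff ℝ 1 f := hf.of_le (by norm_num)
  unfold morMul
  fun_prop

lemma contDiff_gradSq (hf : ContDiff ℝ 2 f) : ContDiff ℝ 1 (gradSq f) := by
  have h3 : ContDiff ℝ 1 (fderiv ℝ f) := hf.fderiv_right (by norm_num)
  unfold gradSq
  fun_prop

lemma hasCompactSupport_morMul (hc : HasCompactSupport f) : HasCompactSupport (morMul e f) := by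
  refine hc.mono' ?_
  intro x hx
  by_contra h
  apply hx
  have h1 : fderiv ℝ f x = 0 := by
    by_contra h2
    exact h (support_fderiv_subset ℝ h2)
  simp [morMul, h1, image_eq_zero_of_notMem_tsupport h]

lemma hasFDerivAt_fderiv_apply (hf : ContDiff ℝ 2 f) (x v : Ed d) :
    HasFDerivAt (fun y => fderiv ℝ f y v) ((fderiv ℝ (fderiv ℝ f) x).flip v) x := by
  have h3 : ContDiff ℝ 1 (fderiv ℝ f) := hf.fderiv_right (by norm_num)
  have := ((h3.differentiable one_ne_zero) x).hasFDerivAt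
  refine (this.clm_apply (hasFDerivAt_const v x)).congr_fderiv ?_
  ext; simp

lemma fderiv_morMul (he : 0 < e) (hf : ContDiff ℝ 2 f) (x v : Ed d) :
    fderiv ℝ (morMul e f) x v =
      -(invJap e x ^ 3) * inner ℝ x v * fderiv ℝ f x x
      + invJap e x * (fderiv ℝ (fderiv ℝ f) x v x + fderiv ℝ f x v)
      - 1 / 2 * japLap₁ e x * inner ℝ x v * f x + 1 / 2 * japLap e x * fderiv ℝ f x v := by
  have h3 : ContDiff ℝ 1 (fderiv ℝ f) := hf.fderiv_right (by norm_num)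
  have h4 := ((h3.differentiable one_ne_zero) x).hasFDerivAt.clm_apply (hasFDerivAt_id x)
  have h5 := (hf.differentiable two_ne_zero x).hasFDerivAt
  have h6 := ((hasFDerivAt_invJap he x).mul h4).add
    (((hasFDerivAt_japLap he x).const_mul (1 / 2)).mul h5)
  have h7 : HasFDerivAt (morMul e f) _ x := h6
  rw [h7.fderiv]
  simp
  ring

lemma fderiv_gradSq (hf : ContDiff ℝ 2 f) (x v : Ed d) :
    fderiv ℝ (gradSq f) x v = 2 * ∑ j, fderiv ℝ f x (EuclideanSpace.single j 1) *
      fderiv ℝ (fderiv ℝ f) x v (EuclideanSpace.single j 1) := by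
  have h := HasFDerivAt.fun_sum (u := Finset.univ) fun (j : Fin d) _ =>
    (hasFDerivAt_fderiv_apply hf x (EuclideanSpace.single j 1)).pow 2
  have h7 : HasFDerivAt (gradSq f) _ x := h
  rw [h7.fderiv]
  simp [Finset.mul_sum]
  refine Finset.sum_congr rfl fun j _ => by ring

/-- The components of the Morawetz flux. -/
def morFlux (e : ℝ) (f : Ed d → ℝ) (i : Fin d) (x : Ed d) : ℝ :=
  fderiv ℝ f x (EuclideanSpace.single i 1) * morMul e f x
    - 1 / 2 * gradSq f x * (invJap e x * x i) + 1 / 4 * f x ^ 2 * (japLap₁ e x * x i)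

lemma fderiv_morFlux (he : 0 < e) (hf : ContDiff ℝ 2 f) (x : Ed d) (i : Fin d) :
    fderiv ℝ (morFlux e f i) x (EuclideanSpace.single i 1) =
      fderiv ℝ (fderiv ℝ f) x (EuclideanSpace.single i 1) (EuclideanSpace.single i 1)
        * morMul e f x
      + fderiv ℝ f x (EuclideanSpace.single i 1)
        * fderiv ℝ (morMul e f) x (EuclideanSpace.single i 1)
      - 1 / 2 * fderiv ℝ (gradSq f) x (EuclideanSpace.single i 1) * invJap e x * x i
      - 1 / 2 * gradSq f x * (invJap e x - invJap e x ^ 3 * x i ^ 2)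
      + 1 / 2 * f x * fderiv ℝ f x (EuclideanSpace.single i 1) * japLap₁ e x * x i
      + 1 / 4 * f x ^ 2 * (japLap₁ e x - japLap₂ e x * x i ^ 2) := by
  have h1 := (hasFDerivAt_fderiv_apply hf x (EuclideanSpace.single i 1)).mul
    (((contDiff_morMul he hf).differentiable one_ne_zero) x).hasFDerivAt
  have hx : HasFDerivAt (fun y : Ed d => y i) (EuclideanSpace.proj i : Ed d →L[ℝ] ℝ) x :=
    (EuclideanSpace.proj i : Ed d →L[ℝ] ℝ).hasFDerivAt
  have h2 := ((((contDiff_gradSq hf).differentiable one_ne_zero) x).hasFDerivAt.const_mul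
    (1 / 2)).mul ((hasFDerivAt_invJap he x).mul hx)
  have h3 := ((((hf.differentiable two_ne_zero) x).hasFDerivAt.pow 2).const_mul
    (1 / 4)).mul ((hasFDerivAt_japLap₁ he x).mul hx)
  have h7 : HasFDerivAt (morFlux e f i) _ x := (h1.sub h2).add h3
  rw [h7.fderiv]
  simp [inner_single_one]
  ring

lemma sum_fderiv_morFlux (he : 0 < e) (hf : ContDiff ℝ 2 f) (x : Ed d) :
    ∑ i, fderiv ℝ (morFlux e f i) x (EuclideanSpace.single i 1) =
      (∑ i, fderiv ℝ (fderiv ℝ f) x (EuclideanSpace.single i 1) (EuclideanSpace.single i 1))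
        * morMul e f x
      + (invJap e x * gradSq f x - invJap e x ^ 3 * fderiv ℝ f x x ^ 2)
      + 1 / 4 * f x ^ 2 * (d * japLap₁ e x - ‖x‖ ^ 2 * japLap₂ e x) := by
  have hsym : ∀ v w, fderiv ℝ (fderiv ℝ f) x v w = fderiv ℝ (fderiv ℝ f) x w v :=
    hf.contDiffAt.isSymmSndFDerivAt (by simp)
  have hN : ∑ i, x i * fderiv ℝ (gradSq f) x (EuclideanSpace.single i 1) =
      2 * ∑ i, fderiv ℝ f x (EuclideanSpace.single i 1) *
        fderiv ℝ (fderiv ℝ f) x (EuclideanSpace.single i 1) x := by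
    rw [sum_coord_mul_apply, fderiv_gradSq hf]
    simp_rw [hsym x]
  have hq := sum_coord_mul_apply (fderiv ℝ f x) x
  have hr : ∑ i, x i ^ 2 = ‖x‖ ^ 2 := (EuclideanSpace.real_norm_sq_eq x).symm
  have hs := invJap_sq_mul he x
  have hg : ∑ i, fderiv ℝ f x (EuclideanSpace.single i 1) ^ 2 = gradSq f x := rfl
  have hsplit : ∀ i, fderiv ℝ (morFlux e f i) x (EuclideanSpace.single i 1) =
      morMul e f x *
        fderiv ℝ (fderiv ℝ f) x (EuclideanSpace.single i 1) (EuclideanSpace.single i 1)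
      + (-(invJap e x ^ 3 * fderiv ℝ f x x)) * (x i * fderiv ℝ f x (EuclideanSpace.single i 1))
      + invJap e x * (fderiv ℝ f x (EuclideanSpace.single i 1) *
          fderiv ℝ (fderiv ℝ f) x (EuclideanSpace.single i 1) x)
      + (invJap e x + 1 / 2 * japLap e x) * fderiv ℝ f x (EuclideanSpace.single i 1) ^ 2
      + (-(1 / 2 * invJap e x)) * (x i * fderiv ℝ (gradSq f) x (EuclideanSpace.single i 1))
      + (1 / 2 * gradSq f x * invJap e x ^ 3 - 1 / 4 * f x ^ 2 * japLap₂ e x) * x i ^ 2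
      + (1 / 4 * f x ^ 2 * japLap₁ e x - 1 / 2 * gradSq f x * invJap e x) := fun i => by
    rw [fderiv_morFlux he hf, fderiv_morMul he hf, inner_single_one]
    ring
  simp_rw [hsplit, Finset.sum_add_distrib, ← Finset.mul_sum, hN, hq, hr, hg]
  simp only [Finset.sum_const, Finset.card_univ, Fintype.card_fin, nsmul_eq_mul, japLap]
  linear_combination (1 / 2 * gradSq f x * invJap e x) * hs

end SpatialIdentities

section SpatialEstimates

variable {d : ℕ} {e : ℝ} {f : Ed d → ℝ}

lemma norm_gradient_sq (f : Ed d → ℝ) (x : Ed d) : ‖gradient f x‖ ^ 2 = gradSq f x := by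
  rw [EuclideanSpace.real_norm_sq_eq, gradSq]
  refine Finset.sum_congr rfl fun i _ => ?_
  rw [← inner_single_one, inner_gradient_left]

lemma fderiv_self_sq_le (f : Ed d → ℝ) (x : Ed d) :
    fderiv ℝ f x x ^ 2 ≤ gradSq f x * ‖x‖ ^ 2 := by
  rw [← norm_gradient_sq, ← inner_gradient_left, ← mul_pow]
  exact sq_le_sq' (by linarith [neg_le_of_abs_le (abs_real_inner_le_norm (gradient f x) x)])
    (real_inner_le_norm _ _)

lemma norm_angularGrad_sq (f : Ed d → ℝ) (x : Ed d) :
    ‖angularGrad f x‖ ^ 2 = gradSq f x - fderiv ℝ f x x ^ 2 / ‖x‖ ^ 2 := by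
  rw [angularGrad, norm_sub_sq_real, norm_gradient_sq]
  rcases eq_or_ne x 0 with rfl | hx
  · simp
  have h : ‖x‖ ≠ 0 := norm_ne_zero_iff.2 hx
  simp [norm_smul, inner_smul_right]
  field_simp
  rw [sq_abs]
  ring

/-- The density of the smoothed Morawetz estimate. -/
def morDens (e : ℝ) (f : Ed d → ℝ) (x : Ed d) : ℝ :=
  invJap e x * gradSq f x - invJap e x ^ 3 * fderiv ℝ f x x ^ 2
    + 1 / 4 * f x ^ 2 * (d * japLap₁ e x - ‖x‖ ^ 2 * japLap₂ e x)

lemma le_morDens (hd : 5 ≤ d) (he : 0 < e) (f : Ed d → ℝ) (x : Ed d) :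
    invJap e x * ‖angularGrad f x‖ ^ 2
      + (((d : ℝ) - 1) * ((d : ℝ) - 3) / 4) * f x ^ 2 * invJap e x ^ 3 ≤ morDens e f x := by
  have hd' : (5 : ℝ) ≤ d := by exact_mod_cast hd
  have hs := invJap_pos he x
  have h1 := invJap_sq_mul he x
  rw [norm_angularGrad_sq, morDens]
  set s := invJap e x
  have hq : s ^ 2 * fderiv ℝ f x x ^ 2 ≤ fderiv ℝ f x x ^ 2 / ‖x‖ ^ 2 := by
    rcases eq_or_ne x 0 with hx | hx
    · simp [hx]
    have h : 0 < ‖x‖ := norm_pos_iff.2 hx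
    rw [le_div_iff₀ (by positivity)]
    nlinarith [mul_nonneg (sq_nonneg (s * fderiv ℝ f x x)) he.le]
  have hw : ((d : ℝ) - 1) * (d - 3) * s ^ 3 ≤ d * japLap₁ e x - ‖x‖ ^ 2 * japLap₂ e x := by
    have : d * japLap₁ e x - ‖x‖ ^ 2 * japLap₂ e x - ((d : ℝ) - 1) * (d - 3) * s ^ 3 =
        e * s ^ 5 * (6 * d - 18) + 15 * e ^ 2 * s ^ 7 := by
      simp only [japLap₁, japLap₂]
      linear_combination (-(3 * ((d : ℝ) - 1) * s ^ 3 + 15 * e * s ^ 5)) * h1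
    have : 0 ≤ e * s ^ 5 * (6 * d - 18) + 15 * e ^ 2 * s ^ 7 := by
      have : 0 ≤ 6 * (d : ℝ) - 18 := by linarith
      positivity
    linarith
  have := mul_le_mul_of_nonneg_left hq hs.le
  have := mul_le_mul_of_nonneg_left hw (by positivity : 0 ≤ 1 / 4 * f x ^ 2)
  linarith

lemma continuous_morDens (he : 0 < e) (hf : ContDiff ℝ 2 f) : Continuous (morDens e f) := by
  have h1 := (contDiff_invJap (d := d) he (n := 1)).continuous
  have h3 := hf.continuous_fderiv two_ne_zero
  have h4 := hf.continuous
  have h5 := (contDiff_gradSq hf).continuous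
  unfold morDens japLap₁ japLap₂
  fun_prop

lemma fderiv_eq_zero_of_notMem_tsupport {x : Ed d} (h : x ∉ tsupport f) : fderiv ℝ f x = 0 := by
  by_contra h2
  exact h (support_fderiv_subset ℝ h2)

lemma integral_laplacian_mul_morMul (he : 0 < e) (hf : ContDiff ℝ 2 f)
    (hc : HasCompactSupport f) :
    ∫ x, (∑ i, fderiv ℝ (fderiv ℝ f) x (EuclideanSpace.single i 1) (EuclideanSpace.single i 1))
        * morMul e f x = -∫ x, morDens e f x := by
  have h3 : ContDiff ℝ 1 (fderiv ℝ f) := hf.fderiv_right (by norm_num)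
  have hm := contDiff_morMul he hf
  have hF : ∀ i, ContDiff ℝ 1 (morFlux e f i) := fun i => by
    have h1 := contDiff_invJap (d := d) he (n := 1)
    have h2 := contDiff_japLap₁ (d := d) he (n := 1)
    have h4 : ContDiff ℝ 1 f := hf.of_le (by norm_num)
    have h5 := contDiff_gradSq hf
    unfold morFlux
    fun_prop
  have hFc : ∀ i, HasCompactSupport (morFlux e f i) := fun i => by
    refine HasCompactSupport.intro hc fun x hx => ?_
    simp [morFlux, gradSq, fderiv_eq_zero_of_notMem_tsupport hx,
      image_eq_zero_of_notMem_tsupport hx]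
  have h0 := integral_sum_fderiv_eq_zero hF hFc
  have hd1 : Integrable (morDens e f) := by
    refine (continuous_morDens he hf).integrable_of_hasCompactSupport
      (HasCompactSupport.intro hc fun x hx => ?_)
    simp [morDens, gradSq, fderiv_eq_zero_of_notMem_tsupport hx,
      image_eq_zero_of_notMem_tsupport hx]
  have hl1 : Integrable fun x => (∑ i, fderiv ℝ (fderiv ℝ f) x (EuclideanSpace.single i 1)
      (EuclideanSpace.single i 1)) * morMul e f x := by
    have := h3.continuous_fderiv one_ne_zero
    have := hm.continuous
    refine Continuous.integrable_of_hasCompactSupport (by fun_prop)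
      (hasCompactSupport_morMul hc).mul_left
  rw [← add_eq_zero_iff_eq_neg, ← integral_add hl1 hd1, ← h0]
  congr 1 with x
  rw [sum_fderiv_morFlux he hf, morDens]
  ring

lemma integral_radial_flux (he : 0 < e) {h : Ed d → ℝ} (hh : ContDiff ℝ 1 h)
    (hc : HasCompactSupport h) :
    ∫ x, (invJap e x * fderiv ℝ h x x + h x * japLap e x) = 0 := by
  have h1 := contDiff_invJap (d := d) he (n := 1)
  rw [← integral_sum_fderiv_eq_zero (F := fun i x => h x * (invJap e x * x i))
    (fun i => by fun_prop) (fun i => hc.mul_right)]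
  congr 1 with x
  have hx : ∀ i, HasFDerivAt (fun y : Ed d => y i) (EuclideanSpace.proj i : Ed d →L[ℝ] ℝ) x :=
    fun i => (EuclideanSpace.proj i : Ed d →L[ℝ] ℝ).hasFDerivAt
  have h2 : ∀ i, fderiv ℝ (fun x => h x * (invJap e x * x i)) x (EuclideanSpace.single i 1) =
      invJap e x * (x i * fderiv ℝ h x (EuclideanSpace.single i 1)) + h x * invJap e x
        + -(h x * invJap e x ^ 3) * x i ^ 2 := fun i => by
    have h7 : HasFDerivAt (fun x => h x * (invJap e x * x i)) _ x :=
      ((hh.differentiable one_ne_zero) x).hasFDerivAt.mul ((hasFDerivAt_invJap he x).mul (hx i))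
    rw [h7.fderiv]
    simp [inner_single_one]
    ring
  simp_rw [h2, Finset.sum_add_distrib, ← Finset.mul_sum, sum_coord_mul_apply,
    ← EuclideanSpace.real_norm_sq_eq]
  simp only [Finset.sum_const, Finset.card_univ, Fintype.card_fin, nsmul_eq_mul, japLap]
  linear_combination (h x * invJap e x) * invJap_sq_mul he x

lemma integral_mul_morMul_self (he : 0 < e) (hf : ContDiff ℝ 1 f) (hc : HasCompactSupport f) :
    ∫ x, f x * morMul e f x = 0 := by
  rw [← integral_radial_flux he (h := fun x => 1 / 2 * f x ^ 2) (by fun_prop)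
    (HasCompactSupport.intro hc fun x hx => by simp [image_eq_zero_of_notMem_tsupport hx])]
  congr 1 with x
  have h7 := (((hf.differentiable one_ne_zero) x).hasFDerivAt.pow 2).const_mul (1 / 2)
  rw [h7.fderiv, morMul]
  simp
  ring

lemma morMul_sq_le_aux {D s q e r G : ℝ} (hD : 5 ≤ D) (he : 0 ≤ e)
    (h1 : s ^ 2 * (r ^ 2 + e) = 1) (hG : 0 ≤ G) (hq : q ^ 2 ≤ G * r ^ 2) (z : ℝ) :
    (s * q + 1 / 2 * ((D - 1) * s + e * s ^ 3) * z) ^ 2 ≤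
      G + (s * (-(1 / 2 * ((D - 1) * s ^ 3 + 3 * e * s ^ 5)) * r ^ 2 * z ^ 2
        + ((D - 1) * s + e * s ^ 3) * z * q) + 1 / 2 * ((D - 1) * s + e * s ^ 3) ^ 2 * z ^ 2) := by
  have hq2 : s ^ 2 * q ^ 2 ≤ G := by
    have := mul_le_mul_of_nonneg_left hq (sq_nonneg s)
    nlinarith [mul_nonneg (mul_nonneg (sq_nonneg s) hG) he]
  have hr : s ^ 2 * r ^ 2 ≤ 1 := by nlinarith [mul_nonneg (sq_nonneg s) he]
  have hD1 : 0 ≤ D - 1 := by linarith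
  have hD3 : 0 ≤ D - 3 := by linarith
  have hD4 : 0 ≤ 2 * D - 8 := by linarith
  have hP : 0 ≤ (D - 1) * s ^ 2 + 3 * e * s ^ 4 := by positivity
  have hb : 1 / 2 * (s ^ 2 * r ^ 2 * ((D - 1) * s ^ 2 + 3 * e * s ^ 4)) ≤
      1 / 4 * ((D - 1) * s + e * s ^ 3) ^ 2 := by
    have h2 := mul_le_mul_of_nonneg_right hr hP
    have h3 : 0 ≤ (D - 1) * (D - 3) * s ^ 2 + (2 * D - 8) * e * s ^ 4 + e ^ 2 * s ^ 6 := by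
      positivity
    linarith
  have hb' := mul_le_mul_of_nonneg_right hb (sq_nonneg z)
  linarith

lemma fderiv_japLap_mul_sq (he : 0 < e) (hf : ContDiff ℝ 1 f) (x v : Ed d) :
    fderiv ℝ (fun y => 1 / 2 * japLap e y * f y ^ 2) x v =
      -(1 / 2 * japLap₁ e x) * ⟪x, v⟫ * f x ^ 2 + japLap e x * f x * fderiv ℝ f x v := by
  have h7 : HasFDerivAt (fun y => 1 / 2 * japLap e y * f y ^ 2) _ x :=
    ((hasFDerivAt_japLap he x).const_mul (1 / 2)).mul
      (((hf.differentiable one_ne_zero) x).hasFDerivAt.pow 2)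
  rw [h7.fderiv]
  simp
  ring

lemma integral_morMul_sq_le (hd : 5 ≤ d) (he : 0 < e) (hf : ContDiff ℝ 2 f)
    (hc : HasCompactSupport f) :
    ∫ x, morMul e f x ^ 2 ≤ ∫ x, gradSq f x := by
  have hd' : (5 : ℝ) ≤ d := by exact_mod_cast hd
  have hf1 : ContDiff ℝ 1 f := hf.of_le (by norm_num)
  have hψ := contDiff_japLap (d := d) he (n := 1)
  have hs' := contDiff_invJap (d := d) he (n := 1)
  have hm := (contDiff_morMul he hf).continuous
  have hg := (contDiff_gradSq hf).continuous
  obtain ⟨h, hh⟩ : ∃ h : Ed d → ℝ, h = fun x => 1 / 2 * japLap e x * f x ^ 2 := ⟨_, rfl⟩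
  have hh1 : ContDiff ℝ 1 h := by rw [hh]; fun_prop
  have hhc : HasCompactSupport h :=
    HasCompactSupport.intro hc fun x hx => by simp [hh, image_eq_zero_of_notMem_tsupport hx]
  have h0 := integral_radial_flux he hh1 hhc
  have i1 : Integrable (gradSq f) := hg.integrable_of_hasCompactSupport
    (HasCompactSupport.intro hc fun x hx => by
      simp [gradSq, fderiv_eq_zero_of_notMem_tsupport hx])
  have i2 : Integrable fun x => invJap e x * fderiv ℝ h x x + h x * japLap e x := by
    have := hh1.continuous_fderiv one_ne_zero
    have := hψ.continuous
    have := hs'.continuous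
    have := hh1.continuous
    exact Continuous.integrable_of_hasCompactSupport (by fun_prop)
      (HasCompactSupport.intro hhc fun x hx => by
        simp [fderiv_eq_zero_of_notMem_tsupport hx, image_eq_zero_of_notMem_tsupport hx])
  have i3 : Integrable fun x => morMul e f x ^ 2 :=
    (hm.pow 2).integrable_of_hasCompactSupport
      (HasCompactSupport.intro (hasCompactSupport_morMul (e := e) hc) fun x hx => by
        simp [image_eq_zero_of_notMem_tsupport hx])
  rw [← add_zero (∫ x, gradSq f x), ← h0, ← integral_add i1 i2]
  refine integral_mono i3 (i1.add i2) fun x => ?_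
  have hG : 0 ≤ gradSq f x := Finset.sum_nonneg fun i _ => sq_nonneg _
  refine (morMul_sq_le_aux hd' he.le (invJap_sq_mul he x) hG (fderiv_self_sq_le f x)
    (f x)).trans_eq ?_
  have hv : fderiv ℝ h x x =
      -(1 / 2 * japLap₁ e x) * ‖x‖ ^ 2 * f x ^ 2 + japLap e x * f x * fderiv ℝ f x x := by
    rw [hh, fderiv_japLap_mul_sq he hf1, real_inner_self_eq_norm_sq]
  rw [hv]
  simp only [hh, japLap, japLap₁]
  ring

end SpatialEstimates

section HartreeSign

variable {d : ℕ} {e r : ℝ} {f : Ed d → ℝ}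

lemma invJap_pow_four (he : 0 < e) (x : Ed d) : invJap e x ^ 4 = ((‖x‖ ^ 2 + e) ^ 2)⁻¹ := by
  have h : 0 < ‖x‖ ^ 2 + e := by positivity
  rw [invJap, inv_pow, show (4 : ℕ) = 2 * 2 from rfl, pow_mul, Real.sq_sqrt h.le]

lemma exists_hartree_bound (hd : 5 ≤ d) (hf : Continuous f) (hc : HasCompactSupport f) :
    ∃ C : ℝ, ∀ x, Integrable (fun y => f y ^ 2 / ‖x - y‖ ^ 4) ∧
      ∫ y, f y ^ 2 / ‖x - y‖ ^ 4 ≤ C := by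
  have hf2 : Integrable fun y => f y ^ 2 :=
    (hf.pow 2).integrable_of_hasCompactSupport (HasCompactSupport.intro hc fun x hx => by
      simp [image_eq_zero_of_notMem_tsupport hx])
  obtain ⟨A, hA⟩ := hc.exists_bound_of_continuous hf
  have hmeas : Measurable fun z : Ed d => (‖z‖ ^ 4)⁻¹ := by fun_prop
  have hloc : LocallyIntegrable (fun z : Ed d => (‖z‖ ^ 4)⁻¹) := by
    refine locallyIntegrable_of_norm_le_rpow (C := 1) (α := 4) (by simp; omega) ?_ ?_
      hmeas.aestronglyMeasurable
    · simp; linarith [(by exact_mod_cast hd : (5 : ℝ) ≤ d)]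
    · refine Eventually.of_forall fun z => ?_
      rw [Real.rpow_neg (norm_nonneg _)]
      norm_cast
      simp
  have hB : Integrable ((Metric.closedBall (0 : Ed d) 1).indicator fun z => (‖z‖ ^ 4)⁻¹) :=
    (integrable_indicator_iff Metric.isClosed_closedBall.measurableSet).2
      (hloc.integrableOn_isCompact (isCompact_closedBall _ _))
  set B := (Metric.closedBall (0 : Ed d) 1).indicator fun z => (‖z‖ ^ 4)⁻¹ with hBdef
  have hdom : ∀ x y, f y ^ 2 / ‖x - y‖ ^ 4 ≤ A ^ 2 * B (x - y) + f y ^ 2 := fun x y => by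
    have h1 : f y ^ 2 ≤ A ^ 2 := by
      rw [← sq_abs]; exact pow_le_pow_left₀ (abs_nonneg _) (hA y) 2
    by_cases h : x - y ∈ Metric.closedBall (0 : Ed d) 1
    · rw [hBdef, Set.indicator_of_mem h, div_eq_mul_inv]
      have := mul_le_mul_of_nonneg_right h1 (by positivity : 0 ≤ (‖x - y‖ ^ 4)⁻¹)
      nlinarith [sq_nonneg (f y)]
    · rw [hBdef, Set.indicator_of_notMem h]
      have h2 : 1 ≤ ‖x - y‖ := by
        rw [mem_closedBall_zero_iff] at h; linarith
      rw [mul_zero, zero_add]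
      exact div_le_self (sq_nonneg _) (one_le_pow₀ h2)
  have hint : ∀ x, Integrable fun y => A ^ 2 * B (x - y) + f y ^ 2 := fun x =>
    ((hB.comp_sub_left x).const_mul _).add hf2
  have hI : ∀ x, Integrable (fun y => f y ^ 2 / ‖x - y‖ ^ 4) := fun x => by
    refine (hint x).mono' ?_ (Eventually.of_forall fun y => ?_)
    · have := hf.measurable
      exact (by fun_prop : Measurable fun y => f y ^ 2 / ‖x - y‖ ^ 4).aestronglyMeasurable
    · rw [Real.norm_of_nonneg (by positivity)]
      exact hdom x y
  refine ⟨A ^ 2 * (∫ z, B z) + ∫ y, f y ^ 2, fun x => ⟨hI x, ?_⟩⟩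
  refine (integral_mono (hI x) (hint x) (hdom x)).trans_eq ?_
  rw [integral_add ((hB.comp_sub_left x).const_mul _) hf2, integral_const_mul,
    integral_sub_left_eq_self B volume x]

lemma integral_kernel_mul_morMul (hr : 0 < r) (he : 0 < e) (hf : ContDiff ℝ 1 f)
    (hc : HasCompactSupport f) (y : Ed d) :
    ∫ x, invJap r (x - y) ^ 4 * (f x * morMul e f x) =
      ∫ x, 2 * invJap r (x - y) ^ 6 * invJap e x * ⟪x - y, x⟫ * f x ^ 2 := by
  have hsr := contDiff_invJap (d := d) hr (n := 1)
  have hse := contDiff_invJap (d := d) he (n := 1)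
  have h0 := integral_radial_flux he
    (h := fun x => 1 / 2 * invJap r (x - y) ^ 4 * f x ^ 2) (by fun_prop)
    (HasCompactSupport.intro hc fun x hx => by simp [image_eq_zero_of_notMem_tsupport hx])
  have hder : ∀ x, fderiv ℝ (fun x => 1 / 2 * invJap r (x - y) ^ 4 * f x ^ 2) x x =
      -2 * invJap r (x - y) ^ 6 * ⟪x - y, x⟫ * f x ^ 2
        + invJap r (x - y) ^ 4 * f x * fderiv ℝ f x x := fun x => by
    have hk := (hasFDerivAt_invJap hr (x - y)).comp x ((hasFDerivAt_id x).sub_const y)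
    have h7 : HasFDerivAt (fun x => 1 / 2 * invJap r (x - y) ^ 4 * f x ^ 2) _ x :=
      ((hk.pow 4).const_mul (1 / 2)).mul
        (((hf.differentiable one_ne_zero) x).hasFDerivAt.pow 2)
    rw [h7.fderiv]
    simp [inner_sub_left]
    ring
  have hf0 := hf.continuous
  have hf1 := hf.continuous_fderiv one_ne_zero
  have hsr0 := hsr.continuous
  have hse0 := hse.continuous
  have hψ := (contDiff_japLap (d := d) he (n := 1)).continuous
  have i1 : Integrable fun x => invJap r (x - y) ^ 4 * (f x * morMul e f x) := by
    unfold morMul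
    exact Continuous.integrable_of_hasCompactSupport (by fun_prop)
      (HasCompactSupport.intro hc fun x hx => by simp [image_eq_zero_of_notMem_tsupport hx])
  have i2 : Integrable fun x =>
      2 * invJap r (x - y) ^ 6 * invJap e x * ⟪x - y, x⟫ * f x ^ 2 :=
    Continuous.integrable_of_hasCompactSupport (by fun_prop)
      (HasCompactSupport.intro hc fun x hx => by simp [image_eq_zero_of_notMem_tsupport hx])
  rw [← sub_eq_zero, ← integral_sub i1 i2, ← h0]
  congr 1 with x
  rw [hder, morMul]
  ring

lemma inner_sub_invJap_smul_nonneg (he : 0 < e) (x y : Ed d) :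
    0 ≤ invJap e x * ⟪x - y, x⟫ + invJap e y * ⟪y - x, y⟫ := by
  have hx := invJap_pos he x
  have hy := invJap_pos he y
  have h1 := invJap_sq_mul he x
  have h2 := invJap_sq_mul he y
  rw [inner_sub_left, inner_sub_left, real_inner_self_eq_norm_sq, real_inner_self_eq_norm_sq,
    real_inner_comm x y]
  have hcs := real_inner_le_norm x y
  set s := invJap e x
  set t := invJap e y
  have hle : s * t * (⟪x, y⟫ + e) ≤ 1 := by
    have h3 : ⟪x, y⟫ + e ≤ ‖x‖ * ‖y‖ + e := by linarith
    refine (mul_le_mul_of_nonneg_left h3 (by positivity)).trans ?_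
    have h4 : (‖x‖ * ‖y‖ + e) ^ 2 ≤ (‖x‖ ^ 2 + e) * (‖y‖ ^ 2 + e) := by
      nlinarith [mul_nonneg he.le (sq_nonneg (‖x‖ - ‖y‖))]
    have h5 : (s * t * (‖x‖ * ‖y‖ + e)) ^ 2 ≤ 1 := by
      calc (s * t * (‖x‖ * ‖y‖ + e)) ^ 2 = (s * t) ^ 2 * (‖x‖ * ‖y‖ + e) ^ 2 := by ring
        _ ≤ (s * t) ^ 2 * ((‖x‖ ^ 2 + e) * (‖y‖ ^ 2 + e)) := by gcongr
        _ = 1 := by linear_combination h1 * (t ^ 2 * (‖y‖ ^ 2 + e)) + h2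
    exact (abs_le_of_sq_le_sq' (by simpa using h5) zero_le_one).2
  have hid : s * t * (s * (‖x‖ ^ 2 - ⟪x, y⟫) + t * (‖y‖ ^ 2 - ⟪x, y⟫)) =
      (s + t) * (1 - s * t * (⟪x, y⟫ + e)) := by
    linear_combination t * h1 + s * h2
  have h6 : 0 ≤ (s + t) * (1 - s * t * (⟪x, y⟫ + e)) :=
    mul_nonneg (by positivity) (by linarith)
  rw [← hid] at h6
  exact nonneg_of_mul_nonneg_right h6 (by positivity)

lemma integrable_prod_of_tsupport {G : Ed d × Ed d → ℝ} (hG : Continuous G)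
    (hc : HasCompactSupport f) (h0 : ∀ p, f p.1 = 0 ∨ f p.2 = 0 → G p = 0) :
    Integrable G (volume.prod volume) := by
  refine hG.integrable_of_hasCompactSupport
    (HasCompactSupport.intro (hc.isCompact.prod hc.isCompact) fun p hp => h0 p ?_)
  by_contra! h
  exact hp ⟨subset_tsupport f h.1, subset_tsupport f h.2⟩

lemma integral_nonneg_of_add_swap_nonneg {Φ : Ed d × Ed d → ℝ}
    (hΦ : Integrable Φ (volume.prod volume)) (h : ∀ p, 0 ≤ Φ p + Φ p.swap) :
    0 ≤ ∫ p, Φ p ∂(volume.prod volume) := by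
  have hsw : ∫ p, Φ p.swap ∂(volume.prod volume) = ∫ p, Φ p ∂(volume.prod volume) :=
    integral_prod_swap Φ
  have hi : Integrable (fun p => Φ p.swap) (volume.prod volume) := hΦ.swap
  have hsum : 0 ≤ ∫ p, (Φ p + Φ p.swap) ∂(volume.prod volume) := integral_nonneg h
  rw [integral_add hΦ hi, hsw] at hsum
  linarith

lemma integral_smoothed_hartree_nonneg (hr : 0 < r) (he : 0 < e) (hf : ContDiff ℝ 1 f)
    (hc : HasCompactSupport f) :
    0 ≤ ∫ x, (∫ y, f y ^ 2 * invJap r (x - y) ^ 4) * (f x * morMul e f x) := by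
  have hsr0 := (contDiff_invJap (d := d) hr (n := 1)).continuous
  have hse0 := (contDiff_invJap (d := d) he (n := 1)).continuous
  have hψ := (contDiff_japLap (d := d) he (n := 1)).continuous
  have hf0 := hf.continuous
  have hf1 := hf.continuous_fderiv one_ne_zero
  obtain ⟨Φ, hΦ⟩ : ∃ Φ : Ed d × Ed d → ℝ, Φ = fun p => 2 * invJap r (p.1 - p.2) ^ 6 *
      invJap e p.1 * ⟪p.1 - p.2, p.1⟫ * f p.1 ^ 2 * f p.2 ^ 2 := ⟨_, rfl⟩
  have iΦ : Integrable Φ (volume.prod volume) :=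
    integrable_prod_of_tsupport (by rw [hΦ]; fun_prop) hc fun p hp => by
      rcases hp with hp | hp <;> simp [hΦ, hp]
  have i1 : Integrable (Function.uncurry fun x y =>
      f y ^ 2 * invJap r (x - y) ^ 4 * (f x * morMul e f x)) (volume.prod volume) :=
    integrable_prod_of_tsupport (by unfold morMul; fun_prop) hc fun p hp => by
      rcases hp with hp | hp <;> simp [Function.uncurry, hp]
  have hΦ0 : 0 ≤ ∫ p, Φ p ∂(volume.prod volume) := by
    refine integral_nonneg_of_add_swap_nonneg iΦ fun p => ?_
    have h1 : invJap r (p.2 - p.1) = invJap r (p.1 - p.2) := by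
      simp only [invJap, norm_sub_rev]
    have h2 : Φ p + Φ p.swap = 2 * invJap r (p.1 - p.2) ^ 6 * (f p.1 ^ 2 * f p.2 ^ 2) *
        (invJap e p.1 * ⟪p.1 - p.2, p.1⟫ + invJap e p.2 * ⟪p.2 - p.1, p.2⟫) := by
      simp only [hΦ, Prod.fst_swap, Prod.snd_swap, h1]
      ring
    rw [h2]
    have := invJap_pos hr (p.1 - p.2)
    exact mul_nonneg (by positivity) (inner_sub_invJap_smul_nonneg he _ _)
  convert hΦ0 using 1
  simp_rw [← integral_mul_const]
  rw [integral_integral_swap i1, integral_prod_symm _ iΦ]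
  congr 1 with y
  have h3 := integral_kernel_mul_morMul hr he hf hc y
  simp_rw [mul_assoc (f y ^ 2), hΦ, integral_const_mul, h3, integral_mul_const, mul_comm]

lemma integral_hartree_mul_morMul_nonneg (hd : 5 ≤ d) (he : 0 < e) (hf : ContDiff ℝ 1 f)
    (hc : HasCompactSupport f) :
    0 ≤ ∫ x, hartreePot f x * (f x * morMul e f x) := by
  have : Nontrivial (Ed d) := by
    have : Nonempty (Fin d) := ⟨⟨0, by omega⟩⟩
    infer_instance
  have hψ := (contDiff_japLap (d := d) he (n := 1)).continuous
  have hse0 := (contDiff_invJap (d := d) he (n := 1)).continuous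
  have hf0 := hf.continuous
  have hf1 := hf.continuous_fderiv one_ne_zero
  obtain ⟨C, hC⟩ := exists_hartree_bound hd hf0 hc
  have hgc : Continuous fun x => f x * morMul e f x := by unfold morMul; fun_prop
  have hg : Integrable fun x => f x * morMul e f x :=
    hgc.integrable_of_hasCompactSupport hc.mul_right
  set δ : ℕ → ℝ := fun n => 1 / ((n : ℝ) + 1) with hδ
  have hδ0 : ∀ n, 0 < δ n := fun n => by positivity
  have hker : ∀ n (x y : Ed d), x ≠ y → f y ^ 2 * invJap (δ n) (x - y) ^ 4 ≤
      f y ^ 2 / ‖x - y‖ ^ 4 := fun n x y hxy => by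
    have h : 0 < ‖x - y‖ := norm_pos_iff.2 (sub_ne_zero.2 hxy)
    rw [invJap_pow_four (hδ0 n), ← div_eq_mul_inv]
    refine div_le_div_of_nonneg_left (sq_nonneg _) (by positivity) ?_
    nlinarith [hδ0 n, mul_pos (hδ0 n) (pow_pos h 2)]
  have hae : ∀ x : Ed d, ∀ᵐ y, x ≠ y := fun x => by
    filter_upwards [compl_mem_ae_iff.2 (measure_singleton x)] with y hy h
    exact hy h.symm
  have hcont : ∀ n, Continuous fun p : Ed d × Ed d => f p.2 ^ 2 * invJap (δ n) (p.1 - p.2) ^ 4 :=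
    fun n => by
      have := (contDiff_invJap (d := d) (hδ0 n) (n := 1)).continuous
      fun_prop
  have hlimy : ∀ x, Tendsto (fun n => ∫ y, f y ^ 2 * invJap (δ n) (x - y) ^ 4) atTop
      (𝓝 (hartreePot f x)) := fun x => by
    refine tendsto_integral_of_dominated_convergence _
      (fun n => ((hcont n).comp (Continuous.prodMk_right x)).aestronglyMeasurable) (hC x).1
      (fun n => ?_) ?_
    · filter_upwards [hae x] with y hy
      rw [Real.norm_of_nonneg]
      · exact hker n x y hy
      · have := invJap_pos (hδ0 n) (x - y); positivity
    · filter_upwards [hae x] with y hy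
      have h : ‖x - y‖ ≠ 0 := norm_ne_zero_iff.2 (sub_ne_zero.2 hy)
      simp_rw [fun n => invJap_pow_four (hδ0 n) (x - y)]
      have h1 : Tendsto (fun n => (‖x - y‖ ^ 2 + δ n) ^ 2) atTop (𝓝 ((‖x - y‖ ^ 2 + 0) ^ 2)) :=
        (tendsto_const_nhds.add tendsto_one_div_add_atTop_nhds_zero_nat).pow 2
      have h2 := (h1.inv₀ (by positivity)).const_mul (f y ^ 2)
      convert h2 using 2
      rw [div_eq_mul_inv]
      ring
  refine ge_of_tendsto (f := fun n => ∫ x, (∫ y, f y ^ 2 * invJap (δ n) (x - y) ^ 4) *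
    (f x * morMul e f x)) (x := atTop) ?_ (Eventually.of_forall fun n =>
      integral_smoothed_hartree_nonneg (hδ0 n) he hf hc)
  refine tendsto_integral_of_dominated_convergence (fun x => C * ‖f x * morMul e f x‖)
    (fun n => ?_) (hg.norm.const_mul C) (fun n => Eventually.of_forall fun x => ?_)
    (Eventually.of_forall fun x => (hlimy x).mul_const _)
  · exact ((hcont n).stronglyMeasurable.integral_prod_right).aestronglyMeasurable.mul
      hgc.aestronglyMeasurable
  · rw [norm_mul]
    refine mul_le_mul_of_nonneg_right ?_ (norm_nonneg _)
    rw [Real.norm_of_nonneg (integral_nonneg fun y => by positivity)]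
    refine (integral_mono_of_nonneg (Eventually.of_forall fun y => by positivity)
      (hC x).1 ?_).trans (hC x).2
    filter_upwards [hae x] with y hy
    exact hker n x y hy

end HartreeSign

section TimeDerivative

variable {d : ℕ} {e : ℝ} {u : ℝ → Ed d → ℝ}

/-- The space-time differential of `u`. -/
def stDeriv (u : ℝ → Ed d → ℝ) : ℝ × Ed d → ℝ × Ed d →L[ℝ] ℝ :=
  fderiv ℝ fun p : ℝ × Ed d => u p.1 p.2

lemma contDiff_stDeriv (hu : ContDiff ℝ 2 fun p : ℝ × Ed d => u p.1 p.2) :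
    ContDiff ℝ 1 (stDeriv u) :=
  hu.fderiv_right (by norm_num)

lemma contDiff_slice (hu : ContDiff ℝ 2 fun p : ℝ × Ed d => u p.1 p.2) (t : ℝ) :
    ContDiff ℝ 2 (u t) :=
  hu.comp (contDiff_prodMk_right t)

lemma hasDerivAt_slice {F : Type*} [NormedAddCommGroup F] [NormedSpace ℝ F]
    {g : ℝ × Ed d → F} (hg : Differentiable ℝ g) (t : ℝ) (x : Ed d) :
    HasDerivAt (fun s => g (s, x)) (fderiv ℝ g (t, x) (1, 0)) t :=
  (hg (t, x)).hasFDerivAt.comp_hasDerivAt t ((hasDerivAt_id t).prodMk (hasDerivAt_const t x))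

lemma fderiv_slice {F : Type*} [NormedAddCommGroup F] [NormedSpace ℝ F]
    {g : ℝ × Ed d → F} (hg : Differentiable ℝ g) (t : ℝ) (x v : Ed d) :
    fderiv ℝ (fun y => g (t, y)) x v = fderiv ℝ g (t, x) (0, v) := by
  have h : HasFDerivAt (fun y => g (t, y)) _ x :=
    (hg (t, x)).hasFDerivAt.comp x (hasFDerivAt_prodMk_right t x)
  rw [h.fderiv]
  simp

/-- The second time derivative `∂ₜₜ u (t,x)`. -/
def timeDeriv₂ (u : ℝ → Ed d → ℝ) (t : ℝ) (x : Ed d) : ℝ :=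
  iteratedDeriv 2 (fun s => u s x) t

variable (hu : ContDiff ℝ 2 fun p : ℝ × Ed d => u p.1 p.2)

section
include hu

lemma timeDeriv_eq (t : ℝ) (x : Ed d) : timeDeriv u t x = stDeriv u (t, x) (1, 0) :=
  (hasDerivAt_slice (hu.differentiable two_ne_zero) t x).deriv

lemma fderiv_slice_eq (t : ℝ) (x v : Ed d) : fderiv ℝ (u t) x v = stDeriv u (t, x) (0, v) :=
  fderiv_slice (hu.differentiable two_ne_zero) t x v

lemma timeDeriv₂_eq (t : ℝ) (x : Ed d) :
    timeDeriv₂ u t x = fderiv ℝ (stDeriv u) (t, x) (1, 0) (1, 0) := by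
  have h : deriv (fun s => u s x) = fun s => stDeriv u (s, x) (1, 0) :=
    funext fun s => timeDeriv_eq hu s x
  rw [timeDeriv₂, iteratedDeriv_succ, iteratedDeriv_one, h]
  exact ((hasDerivAt_slice ((contDiff_stDeriv hu).differentiable one_ne_zero) t x).clm_apply
    (hasDerivAt_const t ((1 : ℝ), (0 : Ed d)))).deriv.trans (by simp)

lemma contDiff_timeDeriv_uncurry :
    ContDiff ℝ 1 fun p : ℝ × Ed d => timeDeriv u p.1 p.2 := by
  have h : (fun p : ℝ × Ed d => timeDeriv u p.1 p.2) = fun p => stDeriv u p (1, 0) :=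
    funext fun p => timeDeriv_eq hu p.1 p.2
  rw [h]
  exact (contDiff_stDeriv hu).clm_apply contDiff_const

lemma contDiff_timeDeriv (t : ℝ) : ContDiff ℝ 1 (timeDeriv u t) :=
  (contDiff_timeDeriv_uncurry hu).comp (contDiff_prodMk_right t)

lemma hasDerivAt_timeDeriv (t : ℝ) (x : Ed d) :
    HasDerivAt (fun s => timeDeriv u s x) (timeDeriv₂ u t x) t := by
  have h := hasDerivAt_slice ((contDiff_timeDeriv_uncurry hu).differentiable one_ne_zero) t x
  rw [timeDeriv₂, iteratedDeriv_succ, iteratedDeriv_one]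
  exact h.differentiableAt.hasDerivAt

lemma hasDerivAt_apply (t : ℝ) (x : Ed d) : HasDerivAt (fun s => u s x) (timeDeriv u t x) t :=
  (hasDerivAt_slice (hu.differentiable two_ne_zero) t x).differentiableAt.hasDerivAt

lemma fderiv_timeDeriv (t : ℝ) (x v : Ed d) :
    fderiv ℝ (timeDeriv u t) x v = fderiv ℝ (stDeriv u) (t, x) (0, v) (1, 0) := by
  have h : timeDeriv u t = fun y => stDeriv u (t, y) (1, 0) :=
    funext fun y => timeDeriv_eq hu t y
  have h1 : HasFDerivAt (fun y => stDeriv u (t, y)) _ x :=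
    (((contDiff_stDeriv hu).differentiable one_ne_zero) (t, x)).hasFDerivAt.comp x
      (hasFDerivAt_prodMk_right t x)
  have h2 := h1.clm_apply (hasFDerivAt_const ((1 : ℝ), (0 : Ed d)) x)
  rw [h, h2.fderiv]
  simp

lemma hasDerivAt_fderiv_slice (t : ℝ) (x v : Ed d) :
    HasDerivAt (fun s => fderiv ℝ (u s) x v) (fderiv ℝ (timeDeriv u t) x v) t := by
  have h : (fun s => fderiv ℝ (u s) x v) = fun s => stDeriv u (s, x) (0, v) :=
    funext fun s => fderiv_slice_eq hu s x v
  have hs : IsSymmSndFDerivAt ℝ (fun p : ℝ × Ed d => u p.1 p.2) (t, x) :=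
    hu.contDiffAt.isSymmSndFDerivAt (by simp)
  have h1 := (hasDerivAt_slice ((contDiff_stDeriv hu).differentiable one_ne_zero) t x).clm_apply
    (hasDerivAt_const t ((0 : ℝ), v))
  rw [h, fderiv_timeDeriv hu t x v]
  refine h1.congr_deriv ?_
  simpa [stDeriv] using (hs (0, v) (1, 0)).symm

lemma hasDerivAt_morMul (t : ℝ) (x : Ed d) :
    HasDerivAt (fun s => morMul e (u s) x) (morMul e (timeDeriv u t) x) t :=
  ((hasDerivAt_fderiv_slice hu t x x).const_mul _).add ((hasDerivAt_apply hu t x).const_mul _)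

/-- The time derivative of the Morawetz density `∂ₜu · Mu`. -/
lemma hasDerivAt_timeDeriv_mul_morMul (t : ℝ) (x : Ed d) :
    HasDerivAt (fun s => timeDeriv u s x * morMul e (u s) x)
      (timeDeriv₂ u t x * morMul e (u t) x
        + timeDeriv u t x * morMul e (timeDeriv u t) x) t :=
  (hasDerivAt_timeDeriv hu t x).mul (hasDerivAt_morMul hu t x)

lemma continuous_morMul_uncurry (he : 0 < e) :
    Continuous fun p : ℝ × Ed d => morMul e (u p.1) p.2 := by
  have h1 := (contDiff_stDeriv hu).continuous
  have h2 := (contDiff_invJap (d := d) he (n := 1)).continuous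
  have h3 := (contDiff_japLap (d := d) he (n := 1)).continuous
  have h4 := hu.continuous
  simp only [morMul, fderiv_slice_eq hu]
  fun_prop

lemma continuous_timeDeriv₂_uncurry :
    Continuous fun p : ℝ × Ed d => timeDeriv₂ u p.1 p.2 := by
  have h1 := (contDiff_stDeriv hu).continuous_fderiv one_ne_zero
  simp only [timeDeriv₂_eq hu]
  fun_prop

lemma continuous_morMul_timeDeriv_uncurry (he : 0 < e) :
    Continuous fun p : ℝ × Ed d => morMul e (timeDeriv u p.1) p.2 := by
  have h1 := (contDiff_stDeriv hu).continuous_fderiv one_ne_zero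
  have h2 := (contDiff_invJap (d := d) he (n := 1)).continuous
  have h3 := (contDiff_japLap (d := d) he (n := 1)).continuous
  have h4 := (contDiff_timeDeriv_uncurry hu).continuous
  simp only [morMul, fderiv_timeDeriv hu]
  fun_prop

lemma continuous_gradSq_uncurry : Continuous fun p : ℝ × Ed d => gradSq (u p.1) p.2 := by
  have h1 := (contDiff_stDeriv hu).continuous
  simp only [gradSq, fderiv_slice_eq hu]
  fun_prop

lemma continuous_morDens_uncurry (he : 0 < e) :
    Continuous fun p : ℝ × Ed d => morDens e (u p.1) p.2 := by
  have h0 := continuous_gradSq_uncurry hu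
  have h1 := (contDiff_stDeriv hu).continuous
  have h2 := (contDiff_invJap (d := d) he (n := 1)).continuous
  have h3 := (contDiff_japLap₁ (d := d) he (n := 1)).continuous
  have h4 := hu.continuous
  have h5 : Continuous (japLap₂ (d := d) e) := by
    unfold japLap₂
    fun_prop
  simp only [morDens, fderiv_slice_eq hu]
  fun_prop

end

end TimeDerivative

section Morawetz

variable {d : ℕ} {a b e R : ℝ} {u : ℝ → Ed d → ℝ}

lemma spaceLaplacian_eq {f : Ed d → ℝ} (hf : ContDiff ℝ 2 f) (x : Ed d) :
    spaceLaplacian f x = ∑ i, fderiv ℝ (fderiv ℝ f) x (EuclideanSpace.single i 1)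
      (EuclideanSpace.single i 1) := by
  refine Finset.sum_congr rfl fun i _ => ?_
  have hl : ∀ s : ℝ, HasDerivAt (fun s : ℝ => x + s • EuclideanSpace.single i (1 : ℝ))
      (EuclideanSpace.single i 1) s := fun s => by
    simpa using ((hasDerivAt_id s).smul_const (EuclideanSpace.single i (1 : ℝ))).const_add x
  have h : deriv (fun s : ℝ => f (x + s • EuclideanSpace.single i 1)) = fun s =>
      fderiv ℝ f (x + s • EuclideanSpace.single i 1) (EuclideanSpace.single i 1) :=
    funext fun s => ((hf.differentiable two_ne_zero _).hasFDerivAt.comp_hasDerivAt s (hl s)).deriv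
  rw [iteratedDeriv_succ, iteratedDeriv_one, h]
  have h2 := (hasFDerivAt_fderiv_apply hf (x + (0 : ℝ) • EuclideanSpace.single i 1)
    (EuclideanSpace.single i 1)).comp_hasDerivAt (0 : ℝ) (hl 0)
  exact h2.deriv.trans (by simp)

lemma integral_deriv_mul_morMul_le (hd : 5 ≤ d) (he : 0 < e)
    (hu : ContDiff ℝ 2 fun p : ℝ × Ed d => u p.1 p.2) {t : ℝ}
    (heq : ∀ x, timeDeriv₂ u t x - spaceLaplacian (u t) x
      + hartreePot (u t) x * u t x = 0)
    (hc : HasCompactSupport (u t)) (hc' : HasCompactSupport (timeDeriv u t)) :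
    ∫ x, (timeDeriv₂ u t x * morMul e (u t) x
        + timeDeriv u t x * morMul e (timeDeriv u t) x) ≤ -∫ x, morDens e (u t) x := by
  have hf := contDiff_slice hu t
  have hm := (contDiff_morMul he hf).continuous
  have hw := contDiff_timeDeriv hu t
  have htt : Continuous (timeDeriv₂ u t) :=
    Continuous.uncurry_left (f := timeDeriv₂ u) t (continuous_timeDeriv₂_uncurry hu)
  have hmw : Continuous (morMul e (timeDeriv u t)) :=
    Continuous.uncurry_left (f := fun t => morMul e (timeDeriv u t)) t
      (continuous_morMul_timeDeriv_uncurry hu he)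
  have hB : Continuous (fderiv ℝ (fderiv ℝ (u t))) :=
    ContDiff.continuous_fderiv (n := 1) (hf.fderiv_right (by norm_num)) one_ne_zero
  have i1 : Integrable fun x => timeDeriv₂ u t x * morMul e (u t) x :=
    (htt.mul hm).integrable_of_hasCompactSupport (hasCompactSupport_morMul hc).mul_left
  have i2 : Integrable fun x => timeDeriv u t x * morMul e (timeDeriv u t) x :=
    (hw.continuous.mul hmw).integrable_of_hasCompactSupport hc'.mul_right
  have i3 : Integrable fun x => (∑ i, fderiv ℝ (fderiv ℝ (u t)) x (EuclideanSpace.single i 1)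
      (EuclideanSpace.single i 1)) * morMul e (u t) x :=
    Continuous.integrable_of_hasCompactSupport (by fun_prop) (hasCompactSupport_morMul hc).mul_left
  have h1 := integral_laplacian_mul_morMul he hf hc
  have h2 := integral_hartree_mul_morMul_nonneg hd he (hf.of_le (by norm_num)) hc
  have h3 := integral_mul_morMul_self he hw hc'
  have h4 : (fun x => hartreePot (u t) x * (u t x * morMul e (u t) x)) = fun x =>
      (∑ i, fderiv ℝ (fderiv ℝ (u t)) x (EuclideanSpace.single i 1)
        (EuclideanSpace.single i 1)) * morMul e (u t) x
      - timeDeriv₂ u t x * morMul e (u t) x := by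
    funext x
    have := heq x
    rw [spaceLaplacian_eq hf] at this
    linear_combination morMul e (u t) x * this
  rw [h4, integral_sub i3 i1, h1] at h2
  rw [integral_add i1 i2, h3]
  linarith

/-- Vanishing outside a ball on an interval passes to the time derivative in the interior. -/
lemma timeDeriv_eq_zero_of_norm_ge
    (hR : ∀ t ∈ Set.Icc a b, ∀ x : Ed d, R ≤ ‖x‖ → u t x = 0) {t : ℝ} (ht : t ∈ Set.Ioo a b)
    {x : Ed d} (hx : R ≤ ‖x‖) : timeDeriv u t x = 0 := by
  have h : (fun s => u s x) =ᶠ[𝓝 t] fun _ => 0 := by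
    filter_upwards [Ioo_mem_nhds ht.1 ht.2] with s hs
    exact hR s (Set.Ioo_subset_Icc_self hs) x hx
  rw [timeDeriv, h.deriv_eq, deriv_const]

lemma tsupport_subset_closedBall {f : Ed d → ℝ} (hf : ∀ x, R ≤ ‖x‖ → f x = 0) :
    tsupport f ⊆ Metric.closedBall 0 R := by
  refine closure_minimal (fun x hx => ?_) Metric.isClosed_closedBall
  by_contra h
  rw [mem_closedBall_zero_iff, not_le] at h
  exact hx (hf x h.le)

lemma hasCompactSupport_of_norm_ge {f : Ed d → ℝ} (hf : ∀ x, R ≤ ‖x‖ → f x = 0) :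
    HasCompactSupport f :=
  HasCompactSupport.intro (isCompact_closedBall 0 R) fun _ hx =>
    image_eq_zero_of_notMem_tsupport fun h => hx (tsupport_subset_closedBall hf h)

lemma setIntegral_closedBall_eq {f g : Ed d → ℝ} (hf : ∀ x, R ≤ ‖x‖ → f x = 0)
    (hg : ∀ x ∉ tsupport f, g x = 0) :
    ∫ x in Metric.closedBall 0 R, g x = ∫ x, g x :=
  setIntegral_eq_integral_of_forall_compl_eq_zero fun x hx =>
    hg x fun h => hx (tsupport_subset_closedBall hf h)

lemma integral_morDens_le (hd : 5 ≤ d) (he : 0 < e) (hab : a ≤ b)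
    (hu : IsWaveHartreeSol (Set.Icc a b) u)
    (hR : ∀ t ∈ Set.Icc a b, ∀ x : Ed d, R ≤ ‖x‖ → u t x = 0) :
    ∫ t in Set.Ioo a b, ∫ x in Metric.closedBall 0 R, morDens e (u t) x ≤
      (∫ x in Metric.closedBall 0 R, timeDeriv u a x * morMul e (u a) x)
        - ∫ x in Metric.closedBall 0 R, timeDeriv u b x * morMul e (u b) x := by
  obtain ⟨hu, heq⟩ := hu
  obtain ⟨K, hK⟩ : ∃ K : Set (Ed d), K = Metric.closedBall 0 R := ⟨_, rfl⟩
  have hKc : IsCompact K := hK ▸ isCompact_closedBall 0 R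
  obtain ⟨G', hG'⟩ : ∃ G' : ℝ × Ed d → ℝ, G' = fun p =>
    timeDeriv₂ u p.1 p.2 * morMul e (u p.1) p.2
        + timeDeriv u p.1 p.2 * morMul e (timeDeriv u p.1) p.2 := ⟨_, rfl⟩
  have c0 := (contDiff_timeDeriv_uncurry hu).continuous
  have c1 := continuous_morMul_uncurry hu he
  have hcont : Continuous G' := by
    rw [hG']
    exact ((continuous_timeDeriv₂_uncurry hu).mul c1).add
      (c0.mul (continuous_morMul_timeDeriv_uncurry hu he))
  have hint : ∀ {g : ℝ × Ed d → ℝ}, Continuous g →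
      Integrable g ((volume.restrict (Set.Ioo a b)).prod (volume.restrict K)) := fun {g} hg => by
    rw [Measure.prod_restrict]
    exact (hg.continuousOn.integrableOn_compact (isCompact_Icc.prod hKc)).mono_set
      (Set.prod_mono_left Set.Ioo_subset_Icc_self)
  have hle : ∫ t in Set.Ioo a b, ∫ x in K, morDens e (u t) x ≤
      ∫ t in Set.Ioo a b, -∫ x in K, G' (t, x) := by
    refine setIntegral_mono_on (hint (continuous_morDens_uncurry hu he)).integral_prod_left
      (hint hcont).integral_prod_left.neg measurableSet_Ioo fun t ht => ?_
    have htI := Set.Ioo_subset_Icc_self ht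
    have hz := hR t htI
    have hc' : HasCompactSupport (timeDeriv u t) :=
      hasCompactSupport_of_norm_ge fun _ hx => timeDeriv_eq_zero_of_norm_ge hR ht hx
    have h1 := integral_deriv_mul_morMul_le hd he hu (heq t htI)
      (hasCompactSupport_of_norm_ge hz) hc'
    have h2 : ∫ x in K, morDens e (u t) x = ∫ x, morDens e (u t) x := by
      rw [hK]
      refine setIntegral_closedBall_eq hz fun _ hx => ?_
      simp [morDens, gradSq, fderiv_eq_zero_of_notMem_tsupport hx,
        image_eq_zero_of_notMem_tsupport hx]
    have h3 : ∫ x in K, G' (t, x) = ∫ x, G' (t, x) := by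
      refine setIntegral_eq_integral_of_forall_compl_eq_zero fun x hx => ?_
      have hx1 : x ∉ tsupport (u t) := fun h => hx (hK ▸ tsupport_subset_closedBall hz h)
      have hx2 : timeDeriv u t x = 0 := by
        refine timeDeriv_eq_zero_of_norm_ge hR ht ?_
        rw [hK, mem_closedBall_zero_iff, not_le] at hx
        exact hx.le
      simp [hG', hx2, morMul, fderiv_eq_zero_of_notMem_tsupport hx1,
        image_eq_zero_of_notMem_tsupport hx1]
    rw [h2, h3, hG']
    linarith
  have hswap : ∫ t in Set.Ioo a b, ∫ x in K, G' (t, x) =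
      ∫ x in K, (timeDeriv u b x * morMul e (u b) x - timeDeriv u a x * morMul e (u a) x) := by
    rw [integral_integral_swap (f := fun t x => G' (t, x)) (hint hcont)]
    refine integral_congr_ae (ae_of_all _ fun x => ?_)
    have hi : IntervalIntegrable (fun t => G' (t, x)) volume a b :=
      (hcont.comp (Continuous.prodMk_left x)).intervalIntegrable a b
    have := intervalIntegral.integral_eq_sub_of_hasDerivAt
      (f := fun s => timeDeriv u s x * morMul e (u s) x) (f' := fun t => G' (t, x))
      (fun t _ => hG' ▸ hasDerivAt_timeDeriv_mul_morMul hu t x) hi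
    rw [intervalIntegral.integral_of_le hab, integral_Ioc_eq_integral_Ioo] at this
    exact this
  have hi : ∀ t, IntegrableOn (fun x => timeDeriv u t x * morMul e (u t) x) K := fun t =>
    ((c0.mul c1).comp (Continuous.prodMk_right t)).continuousOn.integrableOn_compact hKc
  rw [integral_neg, hswap, integral_sub (hi b) (hi a)] at hle
  rw [← hK]
  linarith

lemma two_mul_abs_integral_mul_morMul_le (hd : 5 ≤ d) (he : 0 < e)
    (hu : ContDiff ℝ 2 fun p : ℝ × Ed d => u p.1 p.2) {t : ℝ}
    (hR : ∀ x : Ed d, R ≤ ‖x‖ → u t x = 0) {M : ℝ≥0∞} (hM : M < ⊤)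
    (hE : ∫⁻ x, ENNReal.ofReal (‖gradient (u t) x‖ ^ 2 + timeDeriv u t x ^ 2) ≤ M) :
    2 * |∫ x in Metric.closedBall 0 R, timeDeriv u t x * morMul e (u t) x| ≤ M.toReal := by
  obtain ⟨K, hK⟩ : ∃ K : Set (Ed d), K = Metric.closedBall 0 R := ⟨_, rfl⟩
  have hKc : IsCompact K := hK ▸ isCompact_closedBall 0 R
  have hf := contDiff_slice hu t
  have hw := (contDiff_timeDeriv hu t).continuous
  have hm := (contDiff_morMul he hf).continuous
  have hg := (contDiff_gradSq hf).continuous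
  have hint : ∀ {g : Ed d → ℝ}, Continuous g → IntegrableOn g K := fun hg =>
    hg.continuousOn.integrableOn_compact hKc
  have h1 : ∫ x in K, morMul e (u t) x ^ 2 ≤ ∫ x in K, gradSq (u t) x := by
    rw [hK, setIntegral_closedBall_eq hR, setIntegral_closedBall_eq hR]
    · exact integral_morMul_sq_le hd he hf (hasCompactSupport_of_norm_ge hR)
    · exact fun x hx => by simp [gradSq, fderiv_eq_zero_of_notMem_tsupport hx]
    · exact fun x hx => by simp [morMul, fderiv_eq_zero_of_notMem_tsupport hx,
        image_eq_zero_of_notMem_tsupport hx]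
  have h2 : 2 * |∫ x in K, timeDeriv u t x * morMul e (u t) x| ≤
      ∫ x in K, (morMul e (u t) x ^ 2 + timeDeriv u t x ^ 2) := by
    refine (mul_le_mul_of_nonneg_left abs_integral_le_integral_abs zero_le_two).trans ?_
    rw [← integral_const_mul]
    refine integral_mono (hint (by fun_prop)) (hint (by fun_prop)) fun x => ?_
    simp only [abs_mul]
    nlinarith [sq_nonneg (|timeDeriv u t x| - |morMul e (u t) x|), sq_abs (timeDeriv u t x),
      sq_abs (morMul e (u t) x)]
  have h3 : ∫ x in K, (gradSq (u t) x + timeDeriv u t x ^ 2) ≤ M.toReal := by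
    have hnn : ∀ x, 0 ≤ gradSq (u t) x + timeDeriv u t x ^ 2 := fun x =>
      add_nonneg (Finset.sum_nonneg fun i _ => sq_nonneg _) (sq_nonneg _)
    rw [integral_eq_lintegral_of_nonneg_ae (ae_of_all _ hnn)
      (hg.add (hw.pow 2)).aestronglyMeasurable]
    refine ENNReal.toReal_mono hM.ne ((setLIntegral_le_lintegral _ _).trans ?_)
    simpa only [norm_gradient_sq] using hE
  have i1 : IntegrableOn (fun x => morMul e (u t) x ^ 2) K := hint (by fun_prop)
  have i2 : IntegrableOn (fun x => timeDeriv u t x ^ 2) K := hint (by fun_prop)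
  rw [integral_add i1 i2] at h2
  rw [integral_add (hint hg) i2] at h3
  rw [← hK]
  linarith

end Morawetz

section SingularLimit

variable {d : ℕ} {a b e R : ℝ} {u : ℝ → Ed d → ℝ}

/-- The regularised left-hand side of the angular Morawetz inequality. -/
def angDens (e : ℝ) (f : Ed d → ℝ) (x : Ed d) : ℝ :=
  invJap e x * ‖angularGrad f x‖ ^ 2
    + (((d : ℝ) - 1) * ((d : ℝ) - 3) / 4) * f x ^ 2 * invJap e x ^ 3

lemma angDens_nonneg (hd : 5 ≤ d) (he : 0 < e) (f : Ed d → ℝ) (x : Ed d) :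
    0 ≤ angDens e f x := by
  have h := (invJap_pos he x).le
  have hd' : (5 : ℝ) ≤ d := by exact_mod_cast hd
  have h1 : 0 ≤ (d : ℝ) - 1 := by linarith
  have h3 : 0 ≤ (d : ℝ) - 3 := by linarith
  unfold angDens
  positivity

lemma measurable_angDens_uncurry (he : 0 < e)
    (hu : ContDiff ℝ 2 fun p : ℝ × Ed d => u p.1 p.2) :
    Measurable fun p : ℝ × Ed d => angDens e (u p.1) p.2 := by
  have h1 := (continuous_gradSq_uncurry hu).measurable
  have h2 : Measurable fun p : ℝ × Ed d => stDeriv u p (0, p.2) := by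
    have := (contDiff_stDeriv hu).continuous
    exact Continuous.measurable (by fun_prop)
  have h3 := ((contDiff_invJap (d := d) he (n := 1)).continuous.comp
    (continuous_snd (X := ℝ))).measurable
  have h4 := hu.continuous.measurable
  simp only [Function.comp_def] at h3
  simp only [angDens, norm_angularGrad_sq, fderiv_slice_eq hu]
  fun_prop

lemma lintegral_angDens_le (hd : 5 ≤ d) (he : 0 < e) (hab : a ≤ b)
    (hu : IsWaveHartreeSol (Set.Icc a b) u)
    (hR : ∀ t ∈ Set.Icc a b, ∀ x : Ed d, R ≤ ‖x‖ → u t x = 0) {M : ℝ≥0∞} (hM : M < ⊤)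
    (hE : ∀ t ∈ Set.Icc a b,
      ∫⁻ x, ENNReal.ofReal (‖gradient (u t) x‖ ^ 2 + timeDeriv u t x ^ 2) ≤ M) :
    ∫⁻ t in Set.Icc a b, ∫⁻ x, ENNReal.ofReal (angDens e (u t) x) ≤ M := by
  have hsmooth := hu.1
  have hle := integral_morDens_le hd he hab hu hR
  have hA := two_mul_abs_integral_mul_morMul_le hd he hsmooth
    (hR a (Set.left_mem_Icc.2 hab)) hM (hE a (Set.left_mem_Icc.2 hab))
  have hB := two_mul_abs_integral_mul_morMul_le hd he hsmooth
    (hR b (Set.right_mem_Icc.2 hab)) hM (hE b (Set.right_mem_Icc.2 hab))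
  have hnn : ∀ t x, 0 ≤ morDens e (u t) x := fun t x =>
    (angDens_nonneg hd he (u t) x).trans (le_morDens hd he (u t) x)
  have hint : IntegrableOn (fun t => ∫ x in Metric.closedBall 0 R, morDens e (u t) x)
      (Set.Ioo a b) := by
    have : Integrable (fun p : ℝ × Ed d => morDens e (u p.1) p.2)
        ((volume.restrict (Set.Ioo a b)).prod (volume.restrict (Metric.closedBall 0 R))) := by
      rw [Measure.prod_restrict]
      exact ((continuous_morDens_uncurry hsmooth he).continuousOn.integrableOn_compact
        (isCompact_Icc.prod (isCompact_closedBall 0 R))).mono_set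
          (Set.prod_mono_left Set.Ioo_subset_Icc_self)
    exact this.integral_prod_left
  rw [← restrict_Ioo_eq_restrict_Icc]
  calc ∫⁻ t in Set.Ioo a b, ∫⁻ x, ENNReal.ofReal (angDens e (u t) x)
      ≤ ∫⁻ t in Set.Ioo a b,
          ENNReal.ofReal (∫ x in Metric.closedBall 0 R, morDens e (u t) x) := by
        refine setLIntegral_mono' measurableSet_Ioo fun t ht => ?_
        have hz := hR t (Set.Ioo_subset_Icc_self ht)
        have hf := contDiff_slice hsmooth t
        have hs : ∀ x, x ∉ tsupport (u t) → morDens e (u t) x = 0 := fun x hx => by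
          simp [morDens, gradSq, fderiv_eq_zero_of_notMem_tsupport hx,
            image_eq_zero_of_notMem_tsupport hx]
        rw [setIntegral_closedBall_eq hz hs, ofReal_integral_eq_lintegral_ofReal
          ((continuous_morDens he hf).integrable_of_hasCompactSupport
            (HasCompactSupport.intro (hasCompactSupport_of_norm_ge hz) hs))
          (ae_of_all _ (hnn t))]
        exact lintegral_mono fun x => ENNReal.ofReal_le_ofReal (le_morDens hd he (u t) x)
    _ = ENNReal.ofReal (∫ t in Set.Ioo a b, ∫ x in Metric.closedBall 0 R,
          morDens e (u t) x) :=
        (ofReal_integral_eq_lintegral_ofReal hint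
          (ae_of_all _ fun t => integral_nonneg (hnn t))).symm
    _ ≤ ENNReal.ofReal M.toReal := by
        refine ENNReal.ofReal_le_ofReal (hle.trans ?_)
        have h1 := le_abs_self (∫ x in Metric.closedBall 0 R, timeDeriv u a x * morMul e (u a) x)
        have h2 := neg_abs_le (∫ x in Metric.closedBall 0 R, timeDeriv u b x * morMul e (u b) x)
        linarith
    _ = M := ENNReal.ofReal_toReal hM.ne

lemma ofReal_le_liminf_angDens {δ : ℕ → ℝ} (hδ : Tendsto δ atTop (𝓝 0)) (f : Ed d → ℝ)
    (x : Ed d) :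
    ENNReal.ofReal (‖angularGrad f x‖ ^ 2 / ‖x‖
        + (((d : ℝ) - 1) * ((d : ℝ) - 3) / 4) * f x ^ 2 / ‖x‖ ^ 3) ≤
      liminf (fun n => ENNReal.ofReal (angDens (δ n) f x)) atTop := by
  rcases eq_or_ne x 0 with rfl | hx
  · simp
  have hx' : 0 < ‖x‖ := norm_pos_iff.2 hx
  have h : Tendsto (fun n => invJap (δ n) x) atTop (𝓝 ‖x‖⁻¹) := by
    have h1 : Tendsto (fun n => √(‖x‖ ^ 2 + δ n)) atTop (𝓝 √(‖x‖ ^ 2 + 0)) :=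
      (hδ.const_add _).sqrt
    rw [add_zero, Real.sqrt_sq hx'.le] at h1
    exact h1.inv₀ hx'.ne'
  refine (Tendsto.liminf_eq (ENNReal.tendsto_ofReal ?_)).ge
  have h2 := (h.mul_const (‖angularGrad f x‖ ^ 2)).add
    ((h.pow 3).const_mul ((((d : ℝ) - 1) * ((d : ℝ) - 3) / 4) * f x ^ 2))
  rw [inv_pow, mul_comm ‖x‖⁻¹, ← div_eq_mul_inv, ← div_eq_mul_inv] at h2
  exact h2

end SingularLimit

/-- Angular-gradient/Hardy type Morawetz bound: for `d ≥ 5`, any classical solution on `[a,b]`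
with compact spatial support and finite energy supremum `M` satisfies
`∫_a^b ∫ (|∇_θu|²/|x| + ((d-1)(d-3)/4)|u|²/|x|³) ≤ C(d) · M`. -/
theorem stmt1 (d : ℕ) (hd : 5 ≤ d) :
    ∃ C : ℝ, 0 < C ∧
      ∀ (a b : ℝ), a ≤ b →
      ∀ u : ℝ → Ed d → ℝ, IsWaveHartreeSol (Set.Icc a b) u →
      (∃ R > 0, ∀ t ∈ Set.Icc a b, ∀ x : Ed d, R ≤ ‖x‖ → u t x = 0) →
      ∀ M : ℝ≥0∞,
        M = (⨆ t ∈ Set.Icc a b,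
              ∫⁻ x : Ed d,
                ENNReal.ofReal (‖gradient (u t) x‖ ^ 2 + (timeDeriv u t x) ^ 2)) →
        M < ⊤ →
        (∫⁻ t in Set.Icc a b, ∫⁻ x : Ed d,
            ENNReal.ofReal (‖angularGrad (u t) x‖ ^ 2 / ‖x‖
              + (((d : ℝ) - 1) * ((d : ℝ) - 3) / 4) * (u t x) ^ 2 / ‖x‖ ^ 3))
          ≤ ENNReal.ofReal C * M := by
  refine ⟨1, one_pos, fun a b hab u hu hsupp M hM hMtop => ?_⟩
  obtain ⟨R, -, hR⟩ := hsupp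
  have hE : ∀ t ∈ Set.Icc a b,
      ∫⁻ x, ENNReal.ofReal (‖gradient (u t) x‖ ^ 2 + timeDeriv u t x ^ 2) ≤ M := fun t ht => by
    rw [hM]
    exact le_iSup₂ (f := fun t (_ : t ∈ Set.Icc a b) =>
      ∫⁻ x, ENNReal.ofReal (‖gradient (u t) x‖ ^ 2 + timeDeriv u t x ^ 2)) t ht
  obtain ⟨δ, hδ0, hδ⟩ : ∃ δ : ℕ → ℝ, (∀ n, 0 < δ n) ∧ Tendsto δ atTop (𝓝 0) :=
    ⟨fun n => 1 / ((n : ℝ) + 1), fun n => by positivity, tendsto_one_div_add_atTop_nhds_zero_nat⟩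
  have hmeas : ∀ n, Measurable fun p : ℝ × Ed d => ENNReal.ofReal (angDens (δ n) (u p.1) p.2) :=
    fun n => (measurable_angDens_uncurry (hδ0 n) hu.1).ennreal_ofReal
  have hslice : ∀ n t, Measurable fun x => ENNReal.ofReal (angDens (δ n) (u t) x) := fun n t =>
    Measurable.of_uncurry_left (f := fun t x => ENNReal.ofReal (angDens (δ n) (u t) x)) (hmeas n)
  calc _ ≤ ∫⁻ t in Set.Icc a b,
        liminf (fun n => ∫⁻ x, ENNReal.ofReal (angDens (δ n) (u t) x)) atTop :=
        lintegral_mono fun t => (lintegral_mono fun x =>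
          ofReal_le_liminf_angDens hδ (u t) x).trans (lintegral_liminf_le fun n => hslice n t)
    _ ≤ liminf (fun n => ∫⁻ t in Set.Icc a b,
        ∫⁻ x, ENNReal.ofReal (angDens (δ n) (u t) x)) atTop :=
        lintegral_liminf_le fun n => Measurable.lintegral_prod_right
          (f := fun t x => ENNReal.ofReal (angDens (δ n) (u t) x)) (hmeas n)
    _ ≤ M := liminf_le_of_le (by isBoundedDefault) fun c hc => by
        obtain ⟨n, hn⟩ := hc.exists
        exact hn.trans (lintegral_angDens_le hd (hδ0 n) hab hu hR hMtop hE)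
    _ = ENNReal.ofReal 1 * M := by rw [ENNReal.ofReal_one, one_mul]
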